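/- For every graph G, the partition-boundary width function is submodular: for all ordered partitions π, π' of E(G) (with empty parts allowed), for all parts X ∈ π and Y ∈ π' with X ∪ Y ≠ E(G), it holds that wid(π) + wid(π') ≥ wid(π_{X→complement(Y)}) + wid(π'_{Y→complement(X)}). -/

import Mathlib

/-- The boundary `Δ(X)` of a set `X` of edges of `G`: vertices incident both to
an edge in `X` and to an edge of `G` not in `X`. -/
def edgeBoundary {V : Type*} (G : SimpleGraph V) (X : Set (Sym2 V)) : Set V :=
  {v | (∃ e ∈ X, v ∈ e) ∧ ∃ e' ∈ G.edgeSet \ X, v ∈ e'}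

/-- The boundary `Δ(π)` of an ordered partition `π` of `E(G)`. -/
def partBoundary {V : Type*} (G : SimpleGraph V) (π : List (Set (Sym2 V))) : Set V :=
  {v | ∃ A ∈ π, v ∈ edgeBoundary G A}

/-- The width of an ordered partition of `E(G)`: the size of its boundary. -/
noncomputable def partWidth {V : Type*} (G : SimpleGraph V) (π : List (Set (Sym2 V))) : ℕ :=
  Set.ncard (partBoundary G π)

/-- An ordered partition of `E(G)` (empty parts allowed). -/
def IsEdgePartition {V : Type*} (G : SimpleGraph V) (π : List (Set (Sym2 V))) : Prop :=
  π.Pairwise Disjoint ∧ π.foldr (· ∪ ·) ∅ = G.edgeSet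

/-- The `F`-extension of an ordered partition in its `i`-th part. -/
def extendPart {U : Type*} (π : List (Set U)) (i : ℕ) (F : Set U) : List (Set U) :=
  π.mapIdx (fun j A => if j = i then A ∪ F else A \ F)

theorem mem_foldr_union_iff {U : Type*} (π : List (Set U)) (e : U) :
    e ∈ π.foldr (· ∪ ·) ∅ ↔ ∃ A ∈ π, e ∈ A := by
  induction π with
  | nil => simp
  | cons A π ih => simp [ih]

theorem IsEdgePartition.mem_edgeSet_iff {V : Type*} {G : SimpleGraph V}
    {π : List (Set (Sym2 V))} (hπ : IsEdgePartition G π) (e : Sym2 V) :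
    e ∈ G.edgeSet ↔ ∃ A ∈ π, e ∈ A := by
  rw [← hπ.2, mem_foldr_union_iff]

theorem IsEdgePartition.disjoint {V : Type*} {G : SimpleGraph V} {π : List (Set (Sym2 V))}
    (hπ : IsEdgePartition G π) {k l : ℕ} (hk : k < π.length) (hl : l < π.length) (hkl : k ≠ l) :
    Disjoint π[k] π[l] := by
  have h := List.pairwise_iff_getElem.1 hπ.1
  rcases hkl.lt_or_gt with hlt | hlt
  · exact h k l hk hl hlt
  · exact (h l k hl hk hlt).symm

/-- A vertex lies outside the boundary of a partition exactly when a single part contains all the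
edges at that vertex. -/
theorem notMem_partBoundary_iff {V : Type*} {G : SimpleGraph V} {π : List (Set (Sym2 V))}
    (hπ : IsEdgePartition G π) {i : ℕ} (hi : i < π.length) {v : V} :
    v ∉ partBoundary G π ↔ ∃ (k : ℕ) (hk : k < π.length), G.incidenceSet v ⊆ π[k] := by
  constructor
  · intro h
    rcases (G.incidenceSet v).eq_empty_or_nonempty with h0 | ⟨e, he, hve⟩
    · exact ⟨i, hi, h0 ▸ Set.empty_subset _⟩
    · obtain ⟨A, hA, heA⟩ := (hπ.mem_edgeSet_iff e).1 he
      obtain ⟨k, hk, rfl⟩ := List.getElem_of_mem hA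
      refine ⟨k, hk, fun e' he' => ?_⟩
      by_contra hn
      exact h ⟨_, hA, ⟨e, heA, hve⟩, e', ⟨he'.1, hn⟩, he'.2⟩
  · rintro ⟨k, hk, h⟩ ⟨A, hA, ⟨e, heA, hve⟩, e', ⟨he', hn⟩, hve'⟩
    obtain ⟨l, hl, rfl⟩ := List.getElem_of_mem hA
    have he : e ∈ G.incidenceSet v := ⟨(hπ.mem_edgeSet_iff e).2 ⟨_, hA, heA⟩, hve⟩
    by_cases hkl : k = l
    · subst hkl
      exact hn (h ⟨he', hve'⟩)
    · exact Set.disjoint_left.1 (hπ.disjoint hk hl hkl) (h he) heA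

theorem length_extendPart {U : Type*} (π : List (Set U)) (i : ℕ) (F : Set U) :
    (extendPart π i F).length = π.length := by
  simp [extendPart]

theorem getElem_extendPart {U : Type*} (π : List (Set U)) (i : ℕ) (F : Set U) {k : ℕ}
    (hk : k < (extendPart π i F).length) :
    (extendPart π i F)[k] =
      if k = i then π[k]'(length_extendPart π i F ▸ hk) ∪ F
      else π[k]'(length_extendPart π i F ▸ hk) \ F := by
  simp [extendPart]

theorem IsEdgePartition.extendPart {V : Type*} {G : SimpleGraph V} {π : List (Set (Sym2 V))}
    (hπ : IsEdgePartition G π) {i : ℕ} (hi : i < π.length) {F : Set (Sym2 V)}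
    (hF : F ⊆ G.edgeSet) : IsEdgePartition G (extendPart π i F) := by
  constructor
  · rw [List.pairwise_iff_getElem]
    intro k l hk hl hkl
    have hd := Set.disjoint_left.1
      (hπ.disjoint (length_extendPart π i F ▸ hk) (length_extendPart π i F ▸ hl) hkl.ne)
    rw [getElem_extendPart, getElem_extendPart, Set.disjoint_left]
    intro e hek hel
    have hde := @hd e
    split_ifs at hek hel
    · omega
    · exact hek.elim (fun h => hde h hel.1) hel.2
    · exact hel.elim (hde hek.1) hek.2
    · exact hde hek.1 hel.1
  · ext e
    rw [mem_foldr_union_iff]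
    constructor
    · rintro ⟨A, hA, heA⟩
      obtain ⟨k, hk, rfl⟩ := List.getElem_of_mem hA
      have hmem := List.getElem_mem (length_extendPart π i F ▸ hk : k < π.length)
      rw [getElem_extendPart] at heA
      split_ifs at heA
      · exact heA.elim (fun h => (hπ.mem_edgeSet_iff e).2 ⟨_, hmem, h⟩) (@hF e)
      · exact (hπ.mem_edgeSet_iff e).2 ⟨_, hmem, heA.1⟩
    · intro he
      obtain ⟨A, hA, heA⟩ := (hπ.mem_edgeSet_iff e).1 he
      obtain ⟨k, hk, rfl⟩ := List.getElem_of_mem hA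
      by_cases heF : e ∈ F
      · refine ⟨_, List.getElem_mem ((length_extendPart π i F).symm ▸ hi), ?_⟩
        rw [getElem_extendPart, if_pos rfl]
        exact .inr heF
      · refine ⟨_, List.getElem_mem ((length_extendPart π i F).symm ▸ hk), ?_⟩
        rw [getElem_extendPart]
        split_ifs
        · exact .inl heA
        · exact ⟨heA, heF⟩

theorem notMem_partBoundary_extendPart_iff {V : Type*} {G : SimpleGraph V}
    {π : List (Set (Sym2 V))} (hπ : IsEdgePartition G π) {i : ℕ} (hi : i < π.length)
    {F : Set (Sym2 V)} (hF : F ⊆ G.edgeSet) {v : V} :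
    v ∉ partBoundary G (extendPart π i F) ↔
      G.incidenceSet v ⊆ π[i] ∪ F ∨
        ∃ (k : ℕ) (hk : k < π.length), k ≠ i ∧ G.incidenceSet v ⊆ π[k] \ F := by
  rw [notMem_partBoundary_iff (hπ.extendPart hi hF) ((length_extendPart π i F).symm ▸ hi)]
  constructor
  · rintro ⟨k, hk, h⟩
    rw [getElem_extendPart] at h
    by_cases hki : k = i
    · subst hki
      exact .inl (by simpa using h)
    · exact .inr ⟨k, length_extendPart π i F ▸ hk, hki, by rwa [if_neg hki] at h⟩
  · rintro (h | ⟨k, hk, hki, h⟩)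
    · refine ⟨i, (length_extendPart π i F).symm ▸ hi, ?_⟩
      rwa [getElem_extendPart, if_pos rfl]
    · refine ⟨k, (length_extendPart π i F).symm ▸ hk, ?_⟩
      rwa [getElem_extendPart, if_neg hki]


/-- For every graph `G`, the partition-boundary width function is submodular:
for ordered partitions `π, π'` of `E(G)` with parts `X ∈ π`, `Y ∈ π'` such
that `X ∪ Y ≠ E(G)`,
`wid(π_{X→E∖Y}) + wid(π'_{Y→E∖X}) ≤ wid(π) + wid(π')`. -/
theorem partWidth_submodular {V : Type*} [Fintype V] (G : SimpleGraph V)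
    (π π' : List (Set (Sym2 V))) (hπ : IsEdgePartition G π) (hπ' : IsEdgePartition G π')
    (i j : ℕ) (hi : i < π.length) (hj : j < π'.length)
    (hne : π.get ⟨i, hi⟩ ∪ π'.get ⟨j, hj⟩ ≠ G.edgeSet) :
    partWidth G (extendPart π i (G.edgeSet \ π'.get ⟨j, hj⟩)) +
      partWidth G (extendPart π' j (G.edgeSet \ π.get ⟨i, hi⟩)) ≤
    partWidth G π + partWidth G π' := by
  rw [List.get_eq_getElem, List.get_eq_getElem]
  have key : ∀ v : V,
      (v ∉ partBoundary G π →
        v ∉ partBoundary G (extendPart π i (G.edgeSet \ π'[j])) ∨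
        v ∉ partBoundary G (extendPart π' j (G.edgeSet \ π[i]))) ∧
      (v ∉ partBoundary G π' →
        v ∉ partBoundary G (extendPart π i (G.edgeSet \ π'[j])) ∨
        v ∉ partBoundary G (extendPart π' j (G.edgeSet \ π[i]))) ∧
      (v ∉ partBoundary G π → v ∉ partBoundary G π' →
        v ∉ partBoundary G (extendPart π i (G.edgeSet \ π'[j])) ∧
        v ∉ partBoundary G (extendPart π' j (G.edgeSet \ π[i]))) := by
    intro v
    rw [notMem_partBoundary_iff hπ hi, notMem_partBoundary_iff hπ' hj,
      notMem_partBoundary_extendPart_iff hπ hi Set.sdiff_subset,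
      notMem_partBoundary_extendPart_iff hπ' hj Set.sdiff_subset]
    have sub {ρ : List (Set (Sym2 V))} (hρ : IsEdgePartition G ρ) {m k : ℕ} (hm : m < ρ.length)
        (hk : k < ρ.length) (hkm : k ≠ m) (h : G.incidenceSet v ⊆ ρ[k]) :
        G.incidenceSet v ⊆ G.edgeSet \ ρ[m] := fun e he =>
      ⟨he.1, fun hem => Set.disjoint_left.1 (hρ.disjoint hk hm hkm) (h he) hem⟩
    have diff {X A : Set (Sym2 V)} (hA : G.incidenceSet v ⊆ A) (hX : G.incidenceSet v ⊆ X) :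
        G.incidenceSet v ⊆ A \ (G.edgeSet \ X) := fun e he => ⟨hA he, fun h => h.2 (hX he)⟩
    refine ⟨?_, ?_, ?_⟩
    · rintro ⟨k, hk, h⟩
      by_cases hki : k = i
      · subst hki
        exact .inl (.inl (Set.subset_union_of_subset_left h _))
      · exact .inr (.inl (Set.subset_union_of_subset_right (sub hπ hi hk hki h) _))
    · rintro ⟨k, hk, h⟩
      by_cases hkj : k = j
      · subst hkj
        exact .inr (.inl (Set.subset_union_of_subset_left h _))
      · exact .inl (.inl (Set.subset_union_of_subset_right (sub hπ' hj hk hkj h) _))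
    · rintro ⟨k, hk, h⟩ ⟨l, hl, h'⟩
      by_cases hki : k = i <;> by_cases hlj : l = j
      · subst hki hlj
        exact ⟨.inl (Set.subset_union_of_subset_left h _),
          .inl (Set.subset_union_of_subset_left h' _)⟩
      · subst hki
        exact ⟨.inl (Set.subset_union_of_subset_left h _), .inr ⟨l, hl, hlj, diff h' h⟩⟩
      · subst hlj
        exact ⟨.inr ⟨k, hk, hki, diff h h'⟩, .inl (Set.subset_union_of_subset_left h' _)⟩
      · exact ⟨.inl (Set.subset_union_of_subset_right (sub hπ' hj hl hlj h') _),
          .inl (Set.subset_union_of_subset_right (sub hπ hi hk hki h) _)⟩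
  unfold partWidth
  rw [← Set.ncard_union_add_ncard_inter (partBoundary G (extendPart π i (G.edgeSet \ π'[j]))),
    ← Set.ncard_union_add_ncard_inter (partBoundary G π)]
  refine add_le_add (Set.ncard_le_ncard fun v hv => ?_) (Set.ncard_le_ncard fun v hv => ?_)
  · have := key v
    simp only [Set.mem_union] at hv ⊢
    tauto
  · have := key v
    simp only [Set.mem_inter_iff] at hv ⊢
    tauto
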